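/- arXiv:math/9804116 — 3 statements merged into one kernel-verified Lean document; each statement's English description precedes it below -/
import Mathlib

section
/- Let M ⊂ ℝⁿ be a closed smooth submanifold of dimension d with Riemannian volume measure dμ, and suppose M has polynomial volume growth: there exist constants C > 0 and l ∈ ℕ such that vol_d(M ∩ B_r) ≤ C·r^l for every r > 0. Then the set of restrictions to M of real polynomial functions on ℝⁿ is dense in the Hilbert space L²(M, e^{-|x|²} dμ). -/
open MeasureTheory

/-- `M` is a smooth (i.e. `C^∞`) embedded submanifold of dimension `d` of the euclidean
space `ℝⁿ`: around every point of `M` there is a smooth chart of the ambient space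
straightening `M` into the coordinate subspace of the first `d` coordinates. -/
def IsSmoothSubmanifold (n d : ℕ) (M : Set (EuclideanSpace ℝ (Fin n))) : Prop :=
  ∀ x ∈ M, ∃ φ : PartialHomeomorph (EuclideanSpace ℝ (Fin n)) (EuclideanSpace ℝ (Fin n)),
    x ∈ φ.source ∧ ContDiffOn ℝ (⊤ : ℕ∞) φ φ.source ∧ ContDiffOn ℝ (⊤ : ℕ∞) φ.symm φ.target ∧
    M ∩ φ.source = φ.source ∩ φ ⁻¹' {y | ∀ i : Fin n, d ≤ (i : ℕ) → y i = 0}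

/-- A polynomial is dominated by an exponential of the norm. -/
theorem MvPolynomial.exists_abs_eval_le_exp_norm {n : ℕ} (p : MvPolynomial (Fin n) ℝ) :
    ∃ K a : ℝ, ∀ x : EuclideanSpace ℝ (Fin n),
      |MvPolynomial.eval x p| ≤ K * Real.exp (a * ‖x‖) := by
  induction p using MvPolynomial.induction_on with
  | C c => exact ⟨|c|, 0, fun x => by simp⟩
  | add p q hp hq =>
    obtain ⟨K₁, a₁, h₁⟩ := hp
    obtain ⟨K₂, a₂, h₂⟩ := hq
    have hK {K a : ℝ} {p : MvPolynomial (Fin n) ℝ}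
        (h : ∀ x : EuclideanSpace ℝ (Fin n), |MvPolynomial.eval x p| ≤ K * Real.exp (a * ‖x‖)) :
        0 ≤ K := by
      simpa using (abs_nonneg _).trans (h 0)
    refine ⟨K₁ + K₂, max a₁ a₂, fun x => ?_⟩
    rw [map_add, add_mul]
    refine (abs_add_le _ _).trans (add_le_add ((h₁ x).trans ?_) ((h₂ x).trans ?_))
    · have := hK h₁
      gcongr
      exact le_max_left _ _
    · have := hK h₂
      gcongr
      exact le_max_right _ _
  | mul_X p i hp =>
    obtain ⟨K, a, h⟩ := hp
    refine ⟨K, a + 1, fun x => ?_⟩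
    have hx : |x i| ≤ Real.exp ‖x‖ :=
      (PiLp.norm_apply_le x i).trans (by linarith [Real.add_one_le_exp ‖x‖])
    rw [map_mul, MvPolynomial.eval_X, abs_mul, add_mul, one_mul, Real.exp_add, ← mul_assoc]
    exact mul_le_mul (h x) hx (abs_nonneg _) ((abs_nonneg _).trans (h x))

/-- The linear form `⟪·, ξ⟫` as a polynomial. -/
noncomputable def innerPolynomial {n : ℕ} (ξ : EuclideanSpace ℝ (Fin n)) :
    MvPolynomial (Fin n) ℝ :=
  ∑ i, MvPolynomial.C (ξ i) * MvPolynomial.X i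

theorem eval_innerPolynomial {n : ℕ} (ξ x : EuclideanSpace ℝ (Fin n)) :
    MvPolynomial.eval x (innerPolynomial ξ) = inner ℝ x ξ := by
  simp [innerPolynomial, PiLp.inner_apply]

theorem continuous_eval_euclideanSpace {n : ℕ} (p : MvPolynomial (Fin n) ℝ) :
    Continuous fun x : EuclideanSpace ℝ (Fin n) => MvPolynomial.eval x p :=
  (MvPolynomial.continuous_eval p).comp (PiLp.continuous_ofLp 2 _)

section ExponentialMoments

variable {n : ℕ} {ν : Measure (EuclideanSpace ℝ (Fin n))}

theorem memLp_two_exp_norm (hν : ∀ a : ℝ, Integrable (fun x => Real.exp (a * ‖x‖)) ν) (a : ℝ) :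
    MemLp (fun x => Real.exp (a * ‖x‖)) 2 ν := by
  rw [memLp_two_iff_integrable_sq (hν a).aestronglyMeasurable]
  refine (hν (2 * a)).congr (.of_forall fun x => ?_)
  simp only [← Real.exp_nat_mul]
  push_cast
  ring_nf

theorem memLp_two_eval (hν : ∀ a : ℝ, Integrable (fun x => Real.exp (a * ‖x‖)) ν)
    (p : MvPolynomial (Fin n) ℝ) : MemLp (fun x : EuclideanSpace ℝ (Fin n) => MvPolynomial.eval x p) 2 ν := by
  obtain ⟨K, a, h⟩ := p.exists_abs_eval_le_exp_norm
  exact ((memLp_two_exp_norm hν a).const_mul K).mono'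
    (continuous_eval_euclideanSpace p).aestronglyMeasurable (.of_forall h)

/-- If `f ∈ L²` is orthogonal to all polynomials, then the Fourier transform of `f ν` vanishes. -/
theorem integral_mul_cexp_inner_eq_zero
    (hν : ∀ a : ℝ, Integrable (fun x => Real.exp (a * ‖x‖)) ν)
    {f : EuclideanSpace ℝ (Fin n) → ℝ} (hf : MemLp f 2 ν)
    (hp : ∀ p : MvPolynomial (Fin n) ℝ, ∫ x, f x * MvPolynomial.eval x p ∂ν = 0)
    (ξ : EuclideanSpace ℝ (Fin n)) :
    ∫ x, (f x : ℂ) * Complex.exp ((inner ℝ x ξ : ℝ) * Complex.I) ∂ν = 0 := by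
  have hreal (x : EuclideanSpace ℝ (Fin n)) :
      HasSum (fun k : ℕ => |f x| * ((‖ξ‖ * ‖x‖) ^ k / k.factorial))
        (|f x| * Real.exp (‖ξ‖ * ‖x‖)) := by
    have h := NormedSpace.expSeries_div_hasSum_exp (‖ξ‖ * ‖x‖)
    rw [← Real.exp_eq_exp_ℝ] at h
    exact h.mul_left |f x|
  have hcomplex (x : EuclideanSpace ℝ (Fin n)) :
      HasSum (fun k : ℕ => (f x : ℂ) * (((inner ℝ x ξ : ℝ) * Complex.I) ^ k / k.factorial))
        ((f x : ℂ) * Complex.exp ((inner ℝ x ξ : ℝ) * Complex.I)) := by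
    have h := NormedSpace.expSeries_div_hasSum_exp ((inner ℝ x ξ : ℝ) * Complex.I)
    rw [← Complex.exp_eq_exp_ℂ] at h
    exact h.mul_left (f x : ℂ)
  have hsum : HasSum
      (fun k : ℕ => ∫ x, (f x : ℂ) * (((inner ℝ x ξ : ℝ) * Complex.I) ^ k / k.factorial) ∂ν)
      (∫ x, (f x : ℂ) * Complex.exp ((inner ℝ x ξ : ℝ) * Complex.I) ∂ν) := by
    refine hasSum_integral_of_dominated_convergence
      (fun k x => |f x| * ((‖ξ‖ * ‖x‖) ^ k / k.factorial)) (fun k => ?_)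
      (fun k => .of_forall fun x => ?_) (.of_forall fun x => (hreal x).summable) ?_
      (.of_forall hcomplex)
    · exact (Complex.continuous_ofReal.comp_aestronglyMeasurable hf.1).mul
        (Continuous.aestronglyMeasurable (by fun_prop))
    · simp only [norm_mul, norm_div, norm_pow, Complex.norm_real, Complex.norm_I, mul_one,
        Real.norm_eq_abs, Complex.norm_natCast]
      gcongr
      rw [mul_comm ‖ξ‖]
      exact abs_real_inner_le_norm x ξ
    · simp only [(hreal _).tsum_eq]
      exact hf.norm.integrable_mul (memLp_two_exp_norm hν ‖ξ‖)
  refine hsum.unique ?_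
  convert hasSum_zero (α := ℂ) (β := ℕ) with k
  have hk (x : EuclideanSpace ℝ (Fin n)) :
      (f x : ℂ) * (((inner ℝ x ξ : ℝ) * Complex.I) ^ k / k.factorial) =
        ((f x * MvPolynomial.eval x (innerPolynomial ξ ^ k) : ℝ) : ℂ) *
          (Complex.I ^ k / k.factorial) := by
    rw [map_pow, eval_innerPolynomial]
    push_cast
    ring
  simp only [hk]
  rw [integral_mul_const, integral_complex_ofReal, hp]
  simp

/-- An `L²` function orthogonal to all polynomials vanishes almost everywhere. -/
theorem ae_eq_zero_of_integral_mul_eval_eq_zero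
    (hν : ∀ a : ℝ, Integrable (fun x => Real.exp (a * ‖x‖)) ν)
    {f : EuclideanSpace ℝ (Fin n) → ℝ} (hf : MemLp f 2 ν)
    (hp : ∀ p : MvPolynomial (Fin n) ℝ, ∫ x, f x * MvPolynomial.eval x p ∂ν = 0) :
    f =ᵐ[ν] 0 := by
  have hfi : Integrable f ν := by
    simpa [Pi.mul_def] using hf.integrable_mul (memLp_two_exp_norm hν 0)
  have := isFiniteMeasure_withDensity_ofReal hfi.2
  have := isFiniteMeasure_withDensity_ofReal hfi.neg.2
  have hchar (g : EuclideanSpace ℝ (Fin n) → ℝ) (hg : Integrable g ν)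
      (ξ : EuclideanSpace ℝ (Fin n)) :
      charFun (ν.withDensity fun x => ENNReal.ofReal (g x)) ξ =
        ∫ x, (max (g x) 0) • Complex.exp ((inner ℝ x ξ : ℝ) * Complex.I) ∂ν := by
    rw [charFun_apply, integral_withDensity_eq_integral_toReal_smul₀
      hg.aemeasurable.ennreal_ofReal (.of_forall fun _ => ENNReal.ofReal_lt_top)]
    simp only [ENNReal.toReal_ofReal']
  have hint (g : EuclideanSpace ℝ (Fin n) → ℝ) (hg : Integrable g ν)
      (ξ : EuclideanSpace ℝ (Fin n)) :
      Integrable (fun x => (max (g x) 0) • Complex.exp ((inner ℝ x ξ : ℝ) * Complex.I)) ν := by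
    refine hg.pos_part.smul_bdd 1 (Continuous.aestronglyMeasurable (by fun_prop))
      (.of_forall fun x => (Complex.norm_exp_ofReal_mul_I _).le)
  have heq : (ν.withDensity fun x => ENNReal.ofReal (f x)) =
      ν.withDensity fun x => ENNReal.ofReal ((-f) x) := by
    refine Measure.ext_of_charFun (funext fun ξ => ?_)
    rw [hchar f hfi, hchar (-f) hfi.neg, ← sub_eq_zero,
      ← integral_sub (hint f hfi ξ) (hint (-f) hfi.neg ξ),
      ← integral_mul_cexp_inner_eq_zero hν hf hp ξ]
    congr with x
    rw [← sub_smul, Pi.neg_apply, max_zero_sub_max_neg_zero_eq_self, Complex.real_smul]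
  have hae := (withDensity_eq_iff hfi.aemeasurable.ennreal_ofReal
    hfi.neg.aemeasurable.ennreal_ofReal hfi.lintegral_lt_top.ne).1 heq
  filter_upwards [hae] with x hx
  have hx' := congrArg ENNReal.toReal hx
  simp only [ENNReal.toReal_ofReal', Pi.neg_apply] at hx'
  have := max_zero_sub_max_neg_zero_eq_self (f x)
  simp only [Pi.zero_apply]
  linarith

/-- Polynomials are dense in `L²(ν)` as soon as `ν` has exponential moments of all orders. -/
theorem dense_polynomials_of_integrable_exp_norm
    (hν : ∀ a : ℝ, Integrable (fun x => Real.exp (a * ‖x‖)) ν) :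
    Dense {f : Lp ℝ 2 ν | ∃ p : MvPolynomial (Fin n) ℝ,
      ∀ᵐ x ∂ν, f x = MvPolynomial.eval x p} := by
  let P : Submodule ℝ (Lp ℝ 2 ν) :=
    { carrier := {f | ∃ p : MvPolynomial (Fin n) ℝ, ∀ᵐ x ∂ν, f x = MvPolynomial.eval x p}
      zero_mem' := ⟨0, by
        filter_upwards [Lp.coeFn_zero ℝ 2 ν] with x hx
        rw [hx]
        simp⟩
      add_mem' := by
        rintro f g ⟨p, hp⟩ ⟨q, hq⟩
        refine ⟨p + q, ?_⟩
        filter_upwards [Lp.coeFn_add f g, hp, hq] with x hx hpx hqx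
        rw [hx, Pi.add_apply, hpx, hqx, map_add]
      smul_mem' := by
        rintro c f ⟨p, hp⟩
        refine ⟨c • p, ?_⟩
        filter_upwards [Lp.coeFn_smul c f, hp] with x hx hpx
        rw [hx, Pi.smul_apply, hpx, MvPolynomial.smul_eval, smul_eq_mul] }
  change Dense (P : Set (Lp ℝ 2 ν))
  rw [Submodule.dense_iff_topologicalClosure_eq_top, Submodule.topologicalClosure_eq_top_iff,
    Submodule.eq_bot_iff]
  intro f hf
  rw [Lp.eq_zero_iff_ae_eq_zero]
  refine ae_eq_zero_of_integral_mul_eval_eq_zero hν (Lp.memLp f) fun p => ?_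
  have hpP : (memLp_two_eval hν p).toLp ∈ P := ⟨p, (memLp_two_eval hν p).coeFn_toLp⟩
  rw [← (Submodule.mem_orthogonal P f).1 hf _ hpP, L2.inner_def]
  refine integral_congr_ae ?_
  filter_upwards [(memLp_two_eval hν p).coeFn_toLp] with x hx
  simp [hx]

end ExponentialMoments

/-- `e^{-|x|}` is integrable with respect to a measure of polynomial growth. -/
theorem lintegral_exp_neg_norm_lt_top {E : Type*} [NormedAddCommGroup E] [MeasurableSpace E]
    [OpensMeasurableSpace E] {μ : Measure E} {C : ℝ} (hC : 0 ≤ C) {l : ℕ}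
    (hμ : ∀ r : ℝ, 0 < r → μ (Metric.closedBall 0 r) ≤ ENNReal.ofReal (C * r ^ l)) :
    ∫⁻ x, ENNReal.ofReal (Real.exp (-‖x‖)) ∂μ < ⊤ := by
  let c : ℕ → ENNReal := fun k => ENNReal.ofReal (Real.exp (-k))
  have hpt (x : E) : ENNReal.ofReal (Real.exp (-‖x‖)) ≤
      ∑' k : ℕ, (Metric.closedBall (0 : E) (k + 1)).indicator (fun _ => c k) x := by
    refine le_trans ?_ (ENNReal.le_tsum ⌊‖x‖⌋₊)
    rw [Set.indicator_of_mem (by simpa using (Nat.lt_floor_add_one ‖x‖).le)]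
    exact ENNReal.ofReal_le_ofReal
      (Real.exp_le_exp.2 (neg_le_neg (Nat.floor_le (norm_nonneg x))))
  have hsummable : Summable fun k : ℕ => Real.exp (-k) * (C * (k + 1 : ℝ) ^ l) := by
    have h := (summable_nat_add_iff 1).2 (Real.summable_pow_mul_exp_neg_nat_mul l one_pos)
    refine (h.mul_left (C * Real.exp 1)).congr fun k => ?_
    have : Real.exp (-k) = Real.exp 1 * Real.exp (-1 * ((k + 1 : ℕ) : ℝ)) := by
      rw [← Real.exp_add]
      push_cast
      ring_nf
    rw [this]
    push_cast
    ring
  calc ∫⁻ x, ENNReal.ofReal (Real.exp (-‖x‖)) ∂μ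
      ≤ ∫⁻ x, ∑' k : ℕ, (Metric.closedBall (0 : E) (k + 1)).indicator (fun _ => c k) x ∂μ :=
        lintegral_mono hpt
    _ = ∑' k : ℕ, c k * μ (Metric.closedBall (0 : E) (k + 1)) := by
        rw [lintegral_tsum fun k =>
          (measurable_const.indicator Metric.isClosed_closedBall.measurableSet).aemeasurable]
        simp only [lintegral_indicator_const Metric.isClosed_closedBall.measurableSet]
    _ ≤ ∑' k : ℕ, ENNReal.ofReal (Real.exp (-k) * (C * (k + 1 : ℝ) ^ l)) := by
        refine ENNReal.tsum_le_tsum fun k => ?_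
        rw [ENNReal.ofReal_mul (Real.exp_nonneg _)]
        gcongr
        exact hμ _ (by positivity)
    _ < ⊤ := by
        rw [← ENNReal.ofReal_tsum_of_nonneg (fun k => by positivity) hsummable]
        exact ENNReal.ofReal_lt_top

/-- The Gaussian reweighting of a measure of polynomial growth has all exponential moments. -/
theorem integrable_exp_norm_gaussian {E : Type*} [NormedAddCommGroup E] [MeasurableSpace E]
    [OpensMeasurableSpace E] [SecondCountableTopology E]
    {μ : Measure E} {C : ℝ} (hC : 0 ≤ C) {l : ℕ}
    (hμ : ∀ r : ℝ, 0 < r → μ (Metric.closedBall 0 r) ≤ ENNReal.ofReal (C * r ^ l)) (a : ℝ) :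
    Integrable (fun x => Real.exp (a * ‖x‖))
      (μ.withDensity fun x => ENNReal.ofReal (Real.exp (-‖x‖ ^ 2))) := by
  have hbase : Integrable (fun x : E => Real.exp (-‖x‖)) μ :=
    ⟨Continuous.aestronglyMeasurable (by fun_prop), by
      rw [hasFiniteIntegral_iff_ofReal (.of_forall fun x => Real.exp_nonneg _)]
      exact lintegral_exp_neg_norm_lt_top hC hμ⟩
  rw [integrable_withDensity_iff_integrable_smul'
    (by fun_prop) (.of_forall fun _ => ENNReal.ofReal_lt_top)]
  refine (hbase.const_mul (Real.exp ((a + 1) ^ 2 / 4))).mono'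
    (Continuous.aestronglyMeasurable ?_) (.of_forall fun x => ?_)
  · simp only [ENNReal.toReal_ofReal (Real.exp_nonneg _)]
    fun_prop
  · rw [ENNReal.toReal_ofReal (Real.exp_nonneg _), smul_eq_mul, ← Real.exp_add, ← Real.exp_add,
      Real.norm_eq_abs, Real.abs_exp, Real.exp_le_exp]
    nlinarith [sq_nonneg (‖x‖ - (a + 1) / 2)]

/-- The restrictions to a closed smooth `d`-dimensional submanifold `M ⊂ ℝⁿ` of
polynomial volume growth of the real polynomials on `ℝⁿ` form a dense subspace of
the Hilbert space `L²(M, e^{-|x|²} dμ)`, where `dμ` (the Riemannian volume measure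
of `M`) is the `d`-dimensional Hausdorff measure restricted to `M`. -/
theorem polynomials_dense_in_gaussian_L2
    (n d : ℕ) (M : Set (EuclideanSpace ℝ (Fin n)))
    (hM_closed : IsClosed M)
    (hM_smooth : IsSmoothSubmanifold n d M)
    (C : ℝ) (hC : 0 < C) (l : ℕ)
    (hgrowth : ∀ r : ℝ, 0 < r →
      μH[(d : ℝ)] (M ∩ Metric.closedBall (0 : EuclideanSpace ℝ (Fin n)) r)
        ≤ ENNReal.ofReal (C * r ^ l))
    (ν : Measure (EuclideanSpace ℝ (Fin n)))
    (hν : ν = (μH[(d : ℝ)].restrict M).withDensity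
      fun x => ENNReal.ofReal (Real.exp (-‖x‖ ^ 2))) :
    Dense {f : Lp ℝ 2 ν | ∃ p : MvPolynomial (Fin n) ℝ,
      ∀ᵐ x ∂ν, f x = MvPolynomial.eval x p} := by
  subst hν
  refine dense_polynomials_of_integrable_exp_norm
    (integrable_exp_norm_gaussian hC.le (l := l) fun r hr => ?_)
  rw [Measure.restrict_apply Metric.isClosed_closedBall.measurableSet, Set.inter_comm]
  exact hgrowth r hr
end

section
/- The linear span of the set of functions { x ↦ p(x) e^{-|x|²} : p a real polynomial on ℝⁿ } is dense, with respect to the supremum norm, in the space C₀(ℝⁿ) of continuous real-valued functions on ℝⁿ vanishing at infinity. -/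
open scoped ZeroAtInfty

open Filter Topology

namespace ZeroAtInftyContinuousMap

lemma norm_le_of_forall {X : Type*} [TopologicalSpace X] {f : C₀(X, ℝ)} {C : ℝ} (hC : 0 ≤ C)
    (h : ∀ x, |f x| ≤ C) : ‖f‖ ≤ C := by
  rw [← norm_toBCF_eq_norm]
  exact (BoundedContinuousFunction.norm_le hC).2 h

lemma abs_apply_le_norm {X : Type*} [TopologicalSpace X] (f : C₀(X, ℝ)) (x : X) :
    |f x| ≤ ‖f‖ := by
  rw [← norm_toBCF_eq_norm]
  exact f.toBCF.norm_coe_le_norm x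

/-- Evaluation at a point, as a continuous linear functional on `C₀(X, ℝ)`. -/
noncomputable def evalCLM {X : Type*} [TopologicalSpace X] (x : X) : C₀(X, ℝ) →L[ℝ] ℝ :=
  LinearMap.mkContinuous
    { toFun f := f x
      map_add' _ _ := rfl
      map_smul' _ _ := rfl } 1 fun f ↦ (f.abs_apply_le_norm x).trans (one_mul ‖f‖).ge

/-- The extension by zero of a function vanishing at infinity to the one-point compactification. -/
def toOnePoint {X : Type*} [TopologicalSpace X] [R1Space X] (f : C₀(X, ℝ)) :
    C(OnePoint X, ℝ) :=
  OnePoint.continuousMapMk f.toContinuousMap 0 (by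
    rw [coclosedCompact_eq_cocompact]
    exact f.zero_at_infty')

@[simp]
lemma toOnePoint_coe {X : Type*} [TopologicalSpace X] [R1Space X] (f : C₀(X, ℝ)) (x : X) :
    f.toOnePoint (x : OnePoint X) = f x := rfl

@[simp]
lemma toOnePoint_infty {X : Type*} [TopologicalSpace X] [R1Space X] (f : C₀(X, ℝ)) :
    f.toOnePoint OnePoint.infty = 0 := rfl

/-- The unitization of a subalgebra of `C₀(X, ℝ)`, realised on the one-point compactification. -/
def onePointSubalgebra {X : Type*} [TopologicalSpace X]
    (A : NonUnitalSubalgebra ℝ C₀(X, ℝ)) : Subalgebra ℝ C(OnePoint X, ℝ) where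
  carrier := {g | ∃ h ∈ A, ∀ x : X, g x = g OnePoint.infty + h x}
  mul_mem' := by
    rintro g g' ⟨h, hA, hg⟩ ⟨h', hA', hg'⟩
    refine ⟨h * h' + g OnePoint.infty • h' + g' OnePoint.infty • h,
      A.add_mem (A.add_mem (A.mul_mem hA hA') (A.smul_mem _ hA')) (A.smul_mem _ hA), fun x ↦ ?_⟩
    simp only [ContinuousMap.mul_apply, hg, hg', add_apply, mul_apply, smul_apply, smul_eq_mul]
    ring
  add_mem' := by
    rintro g g' ⟨h, hA, hg⟩ ⟨h', hA', hg'⟩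
    refine ⟨h + h', A.add_mem hA hA', fun x ↦ ?_⟩
    simp only [ContinuousMap.add_apply, hg, hg', add_apply]
    ring
  algebraMap_mem' r := ⟨0, A.zero_mem, fun x ↦ by simp⟩

/-- The **Stone-Weierstrass theorem** for real functions vanishing at infinity. -/
theorem dense_of_separatesPoints {X : Type*} [TopologicalSpace X] [R1Space X]
    (A : NonUnitalSubalgebra ℝ C₀(X, ℝ)) (hsep : ∀ x y : X, x ≠ y → ∃ f ∈ A, f x ≠ f y)
    (hne : ∀ x : X, ∃ f ∈ A, f x ≠ 0) : Dense (A : Set C₀(X, ℝ)) := by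
  have hmem : ∀ f ∈ A, f.toOnePoint ∈ onePointSubalgebra A := fun f hf ↦
    ⟨f, hf, fun x ↦ by simp⟩
  have hsep' : (onePointSubalgebra A).SeparatesPoints := by
    intro x y hxy
    induction x using OnePoint.rec with
    | infty =>
      induction y using OnePoint.rec with
      | infty => exact absurd rfl hxy
      | coe y =>
        obtain ⟨f, hf, hfy⟩ := hne y
        exact ⟨_, ⟨_, hmem f hf, rfl⟩, by simpa using hfy.symm⟩
    | coe x =>
      induction y using OnePoint.rec with
      | infty =>
        obtain ⟨f, hf, hfx⟩ := hne x
        exact ⟨_, ⟨_, hmem f hf, rfl⟩, by simpa using hfx⟩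
      | coe y =>
        obtain ⟨f, hf, hfxy⟩ := hsep x y fun h ↦ hxy (congrArg _ h)
        exact ⟨_, ⟨_, hmem f hf, rfl⟩, by simpa using hfxy⟩
  refine Metric.dense_iff.2 fun f ε hε ↦ ?_
  obtain ⟨⟨g, h, hA, hg⟩, hgf⟩ :=
    ContinuousMap.exists_mem_subalgebra_near_continuousMap_of_separatesPoints _ hsep' f.toOnePoint
      (ε / 3) (by positivity)
  refine ⟨h, ?_, hA⟩
  have hle := fun x ↦ ((g - f.toOnePoint).norm_coe_le_norm x).trans hgf.le
  rw [Metric.mem_ball, dist_eq_norm]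
  refine (norm_le_of_forall (C := 2 * (ε / 3)) (by positivity) fun x ↦ ?_).trans_lt (by linarith)
  have hx := hle x
  have hinf := hle OnePoint.infty
  simp only [ContinuousMap.sub_apply, toOnePoint_coe, toOnePoint_infty, Real.norm_eq_abs,
    abs_le, hg] at hx hinf
  rw [sub_apply, abs_le]
  constructor <;> linarith

end ZeroAtInftyContinuousMap

namespace MvPolynomial

variable {n : ℕ}

lemma exists_abs_eval_le_mul_exp (p : MvPolynomial (Fin n) ℝ) {ε : ℝ} (hε : 0 < ε) :
    ∃ C, 0 ≤ C ∧ ∀ x : EuclideanSpace ℝ (Fin n), |eval x p| ≤ C * Real.exp (ε * ‖x‖ ^ 2) := by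
  induction p using MvPolynomial.induction_on generalizing ε with
  | C a =>
    refine ⟨|a|, abs_nonneg a, fun x ↦ ?_⟩
    rw [eval_C]
    exact le_mul_of_one_le_right (abs_nonneg a) (Real.one_le_exp (by positivity))
  | add p q hp hq =>
    obtain ⟨C, hC, hpC⟩ := hp hε
    obtain ⟨D, hD, hqD⟩ := hq hε
    refine ⟨C + D, by positivity, fun x ↦ ?_⟩
    rw [eval_add, add_mul]
    exact (abs_add_le _ _).trans (add_le_add (hpC x) (hqD x))
  | mul_X p i hp =>
    obtain ⟨C, hC, hpC⟩ := hp (half_pos hε)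
    refine ⟨C * (1 + 2 / ε), by positivity, fun x ↦ ?_⟩
    have hx : |x i| ≤ (1 + 2 / ε) * Real.exp (ε / 2 * ‖x‖ ^ 2) := by
      have h1 : |x i| ≤ ‖x‖ := PiLp.norm_apply_le x i
      have h2 := Real.add_one_le_exp (ε / 2 * ‖x‖ ^ 2)
      have h3 : (1 + 2 / ε) * (ε / 2 * ‖x‖ ^ 2 + 1)
          = ‖x‖ ^ 2 + 1 + ε / 2 * ‖x‖ ^ 2 + 2 / ε := by field_simp; ring
      have h4 : 0 ≤ ε / 2 * ‖x‖ ^ 2 + 2 / ε := by positivity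
      calc |x i| ≤ (1 + 2 / ε) * (ε / 2 * ‖x‖ ^ 2 + 1) := by
            nlinarith [sq_nonneg (‖x‖ - 1)]
        _ ≤ _ := by gcongr
    calc |eval x (p * X i)| = |eval x p| * |x i| := by rw [eval_mul, eval_X, abs_mul]
      _ ≤ C * Real.exp (ε / 2 * ‖x‖ ^ 2) * ((1 + 2 / ε) * Real.exp (ε / 2 * ‖x‖ ^ 2)) := by
        gcongr
        exact hpC x
      _ = C * (1 + 2 / ε) * Real.exp (ε / 2 * ‖x‖ ^ 2 + ε / 2 * ‖x‖ ^ 2) := by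
        rw [Real.exp_add]; ring
      _ = _ := by rw [← add_mul, add_halves]

lemma tendsto_eval_mul_exp_cocompact (p : MvPolynomial (Fin n) ℝ) {b : ℝ} (hb : 0 < b) :
    Tendsto (fun x : EuclideanSpace ℝ (Fin n) ↦ eval x p * Real.exp (-b * ‖x‖ ^ 2))
      (cocompact _) (𝓝 0) := by
  obtain ⟨C, -, hC⟩ := p.exists_abs_eval_le_mul_exp (half_pos hb)
  have hlim : Tendsto (fun x : EuclideanSpace ℝ (Fin n) ↦ C * Real.exp (-(b / 2 * ‖x‖ ^ 2)))
      (cocompact _) (𝓝 0) := by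
    rw [← mul_zero C]
    refine (Real.tendsto_exp_neg_atTop_nhds_zero.comp ?_).const_mul C
    exact ((tendsto_pow_atTop two_ne_zero).comp tendsto_norm_cocompact_atTop).const_mul_atTop
      (half_pos hb)
  refine squeeze_zero_norm (fun x ↦ ?_) hlim
  rw [norm_mul, Real.norm_eq_abs, Real.norm_eq_abs, Real.abs_exp]
  calc |eval x p| * Real.exp (-b * ‖x‖ ^ 2)
      ≤ C * Real.exp (b / 2 * ‖x‖ ^ 2) * Real.exp (-b * ‖x‖ ^ 2) := by gcongr; exact hC x
    _ = C * Real.exp (-(b / 2 * ‖x‖ ^ 2)) := by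
      rw [mul_assoc, ← Real.exp_add]; ring_nf

/-- The function `x ↦ p(x) e^{-b|x|²}` on `ℝⁿ`, vanishing at infinity. -/
noncomputable def mulGaussian (p : MvPolynomial (Fin n) ℝ) (b : ℝ) (hb : 0 < b) :
    C₀(EuclideanSpace ℝ (Fin n), ℝ) where
  toFun x := eval x p * Real.exp (-b * ‖x‖ ^ 2)
  continuous_toFun := by
    have : Continuous fun x : EuclideanSpace ℝ (Fin n) ↦ eval x p :=
      p.continuous_eval.comp (PiLp.continuous_ofLp 2 _)
    fun_prop
  zero_at_infty' := p.tendsto_eval_mul_exp_cocompact hb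

@[simp]
lemma mulGaussian_apply (p : MvPolynomial (Fin n) ℝ) (b : ℝ) (hb : 0 < b)
    (x : EuclideanSpace ℝ (Fin n)) :
    p.mulGaussian b hb x = eval x p * Real.exp (-b * ‖x‖ ^ 2) := rfl

lemma eval_sum_X_sq (x : EuclideanSpace ℝ (Fin n)) :
    eval x (∑ i, X i ^ 2 : MvPolynomial (Fin n) ℝ) = ‖x‖ ^ 2 := by
  simp [EuclideanSpace.norm_sq_eq]

/-- Expanding `e^{-|x|²/2}` in a power series, which converges in the sup norm against
`p(x) e^{-b|x|²}` for `b ≥ 1`. -/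
lemma mulGaussian_add_half_mem {M : Submodule ℝ C₀(EuclideanSpace ℝ (Fin n), ℝ)}
    (hM : IsClosed (M : Set C₀(EuclideanSpace ℝ (Fin n), ℝ))) {b : ℝ} (hb : 1 ≤ b)
    (h : ∀ p : MvPolynomial (Fin n) ℝ, p.mulGaussian b (by linarith) ∈ M)
    (p : MvPolynomial (Fin n) ℝ) : p.mulGaussian (b + 1 / 2) (by linarith) ∈ M := by
  set q : ℕ → MvPolynomial (Fin n) ℝ := fun k ↦
    p * (C ((-1 / 2) ^ k / (k.factorial : ℝ)) * (∑ i, X i ^ 2) ^ k) with hq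
  have hb0 : 0 < b := by linarith
  have hq_eval (k : ℕ) (x : EuclideanSpace ℝ (Fin n)) :
      eval x (q k) = eval x p * ((-(‖x‖ ^ 2 / 2)) ^ k / k.factorial) := by
    simp only [hq, eval_mul, eval_C, eval_pow, eval_sum_X_sq]
    rw [div_mul_eq_mul_div, ← mul_pow]
    congr 3
    ring
  obtain ⟨D, hD, hpD⟩ := p.exists_abs_eval_le_mul_exp (show (0 : ℝ) < 1 / 4 by norm_num)
  have hnorm (k : ℕ) : ‖(q k).mulGaussian b hb0‖ ≤ D * (2 / 3) ^ k := by
    refine ZeroAtInftyContinuousMap.norm_le_of_forall (by positivity) fun x ↦ ?_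
    have hpow : (‖x‖ ^ 2 / 2) ^ k / k.factorial ≤ (2 / 3) ^ k * Real.exp (3 / 4 * ‖x‖ ^ 2) := by
      have := Real.pow_div_factorial_le_exp (3 / 4 * ‖x‖ ^ 2) (by positivity) k
      calc (‖x‖ ^ 2 / 2) ^ k / k.factorial
          = (2 / 3) ^ k * ((3 / 4 * ‖x‖ ^ 2) ^ k / k.factorial) := by
            rw [← mul_div_assoc, ← mul_pow]; ring_nf
        _ ≤ _ := by gcongr
    rw [mulGaussian_apply, hq_eval, abs_mul, abs_mul, abs_div, abs_pow, abs_neg, Real.abs_exp,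
      Nat.abs_cast, abs_of_nonneg (by positivity : 0 ≤ ‖x‖ ^ 2 / 2)]
    calc |eval x p| * ((‖x‖ ^ 2 / 2) ^ k / k.factorial) * Real.exp (-b * ‖x‖ ^ 2)
        ≤ D * Real.exp (1 / 4 * ‖x‖ ^ 2) * ((2 / 3) ^ k * Real.exp (3 / 4 * ‖x‖ ^ 2)) *
            Real.exp (-1 * ‖x‖ ^ 2) := by
          gcongr
          exact hpD x
      _ = D * (2 / 3) ^ k *
            Real.exp (1 / 4 * ‖x‖ ^ 2 + 3 / 4 * ‖x‖ ^ 2 + -1 * ‖x‖ ^ 2) := by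
          rw [Real.exp_add, Real.exp_add]; ring
      _ = D * (2 / 3) ^ k := by
          rw [← add_mul, ← add_mul]; norm_num
  have hsum : Summable fun k ↦ (q k).mulGaussian b hb0 :=
    Summable.of_norm_bounded
      ((summable_geometric_of_lt_one (by norm_num) (by norm_num)).mul_left D) hnorm
  suffices p.mulGaussian (b + 1 / 2) (by linarith) = ∑' k, (q k).mulGaussian b hb0 by
    rw [this]
    exact hM.mem_of_tendsto hsum.hasSum.tendsto_sum_nat
      (Eventually.of_forall fun N ↦ M.sum_mem fun k _ ↦ h _)
  ext x
  have h1 : HasSum (fun k ↦ (q k).mulGaussian b hb0 x) ((∑' k, (q k).mulGaussian b hb0) x) :=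
    (ZeroAtInftyContinuousMap.evalCLM x).hasSum hsum.hasSum
  have h2 : HasSum (fun k ↦ (q k).mulGaussian b hb0 x)
      (eval x p * Real.exp (-(‖x‖ ^ 2 / 2)) * Real.exp (-b * ‖x‖ ^ 2)) := by
    simp only [mulGaussian_apply, hq_eval]
    refine (HasSum.mul_left _ ?_).mul_right _
    rw [Real.exp_eq_exp_ℝ]
    exact NormedSpace.expSeries_div_hasSum_exp _
  rw [← h2.unique h1, mulGaussian_apply, mul_assoc, ← Real.exp_add]
  ring_nf

lemma mulGaussian_natCast_mem {M : Submodule ℝ C₀(EuclideanSpace ℝ (Fin n), ℝ)}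
    (hM : IsClosed (M : Set C₀(EuclideanSpace ℝ (Fin n), ℝ)))
    (h : ∀ p : MvPolynomial (Fin n) ℝ, p.mulGaussian 1 one_pos ∈ M) (m : ℕ)
    (p : MvPolynomial (Fin n) ℝ) : p.mulGaussian (m + 1) (by positivity) ∈ M := by
  induction m generalizing p with
  | zero => simpa using h p
  | succ m ih =>
    have hm : (0 : ℝ) ≤ m := m.cast_nonneg
    have := mulGaussian_add_half_mem hM (by linarith)
      (mulGaussian_add_half_mem hM (by linarith) ih) p
    convert this using 2
    push_cast
    ring

variable (n) in
/-- The functions `x ↦ p(x) e^{-(m+1)|x|²}`, a multiplicatively closed set. -/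
def gaussianSubsemigroup : Subsemigroup C₀(EuclideanSpace ℝ (Fin n), ℝ) where
  carrier := {f | ∃ (m : ℕ) (p : MvPolynomial (Fin n) ℝ),
    f = p.mulGaussian (m + 1) (by positivity)}
  mul_mem' := by
    rintro _ _ ⟨m, p, rfl⟩ ⟨k, q, rfl⟩
    refine ⟨m + k + 1, p * q, ?_⟩
    ext x
    simp only [ZeroAtInftyContinuousMap.mul_apply, mulGaussian_apply, eval_mul]
    rw [mul_mul_mul_comm, ← Real.exp_add]
    push_cast
    ring_nf

variable (n) in
lemma dense_adjoin_gaussianSubsemigroup :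
    Dense (NonUnitalAlgebra.adjoin ℝ
      (gaussianSubsemigroup n : Set C₀(EuclideanSpace ℝ (Fin n), ℝ)) :
        Set C₀(EuclideanSpace ℝ (Fin n), ℝ)) := by
  have hmem (p : MvPolynomial (Fin n) ℝ) : p.mulGaussian 1 one_pos ∈
      NonUnitalAlgebra.adjoin ℝ
        (gaussianSubsemigroup n : Set C₀(EuclideanSpace ℝ (Fin n), ℝ)) :=
    NonUnitalAlgebra.subset_adjoin ℝ ⟨0, p, by simp⟩
  refine ZeroAtInftyContinuousMap.dense_of_separatesPoints _ (fun x y hxy ↦ ?_)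
    fun x ↦ ⟨_, hmem 1, by simp⟩
  by_contra! hall
  refine hxy ?_
  have h1 := hall _ (hmem 1)
  simp only [mulGaussian_apply, map_one, one_mul] at h1
  ext i
  have h2 := hall _ (hmem (X i))
  simp only [mulGaussian_apply, eval_X] at h2
  rw [h1] at h2
  exact mul_right_cancel₀ (Real.exp_ne_zero _) h2

end MvPolynomial

/-- The linear span of the functions `x ↦ p(x) e^{-|x|²}`, for `p` a real polynomial on
`ℝⁿ`, is dense in the space `C₀(ℝⁿ)` of continuous functions vanishing at infinity
(with the supremum norm). -/
theorem polynomial_gaussian_span_dense_in_C0 (n : ℕ) :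
    Dense ((Submodule.span ℝ
        {f : C₀(EuclideanSpace ℝ (Fin n), ℝ) | ∃ p : MvPolynomial (Fin n) ℝ,
          ∀ x, f x = MvPolynomial.eval x p * Real.exp (-‖x‖ ^ 2)} :
      Submodule ℝ C₀(EuclideanSpace ℝ (Fin n), ℝ)) : Set C₀(EuclideanSpace ℝ (Fin n), ℝ)) := by
  set S := Submodule.span ℝ
        {f : C₀(EuclideanSpace ℝ (Fin n), ℝ) | ∃ p : MvPolynomial (Fin n) ℝ,
          ∀ x, f x = MvPolynomial.eval x p * Real.exp (-‖x‖ ^ 2)}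
  have hS (p : MvPolynomial (Fin n) ℝ) : p.mulGaussian 1 one_pos ∈ S.topologicalClosure :=
    S.le_topologicalClosure (Submodule.subset_span ⟨p, fun x ↦ by simp⟩)
  have hle : (NonUnitalAlgebra.adjoin ℝ (MvPolynomial.gaussianSubsemigroup n :
      Set C₀(EuclideanSpace ℝ (Fin n), ℝ))).toSubmodule ≤ S.topologicalClosure := by
    rw [NonUnitalAlgebra.adjoin_eq_span, Subsemigroup.closure_eq, Submodule.span_le]
    rintro _ ⟨m, p, rfl⟩
    exact MvPolynomial.mulGaussian_natCast_mem S.isClosed_topologicalClosure hS m p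
  rw [← dense_closure]
  exact (MvPolynomial.dense_adjoin_gaussianSubsemigroup n).mono hle
end

section
/- Let f: ℝ → ℝⁿ be a polynomial map and let M = {(x, f(x)) : x ∈ ℝ} ⊂ ℝ^{n+1} be its graph. Then the polynomial ring ℝ[x] in one variable is dense in the Hilbert space L²(ℝ, e^{-(x² + ‖f(x)‖²)} √(1 + ‖f'(x)‖²) dx). -/
open MeasureTheory

/-- An integrable real function with vanishing Fourier transform is zero almost everywhere. -/
theorem ae_eq_zero_of_forall_integral_cexp_mul_eq_zero {ν : Measure ℝ} {h : ℝ → ℝ}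
    (hm : Measurable h) (hi : Integrable h ν)
    (h0 : ∀ t : ℝ, ∫ x, Complex.exp (t * x * Complex.I) * (h x : ℂ) ∂ν = 0) :
    h =ᵐ[ν] 0 := by
  have hexp : ∀ t : ℝ, Continuous fun x : ℝ => Complex.exp (t * x * Complex.I) := by
    intro t; fun_prop
  have hnorm : ∀ t x : ℝ, ‖Complex.exp (t * x * Complex.I)‖ ≤ 1 := by
    intro t x
    have := Complex.norm_exp_ofReal_mul_I (t * x)
    push_cast at this
    exact this.le
  have hint : ∀ (g : ℝ → ℝ), Integrable g ν → ∀ t : ℝ,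
      Integrable (fun x => g x • Complex.exp (t * x * Complex.I)) ν := by
    intro g hg t
    have := hg.ofReal (𝕜 := ℂ).bdd_mul (c := 1) (hexp t).aestronglyMeasurable
      (Filter.Eventually.of_forall (hnorm t))
    refine this.congr (Filter.Eventually.of_forall fun x => ?_)
    simp [mul_comm]
  have := isFiniteMeasure_withDensity_ofReal hi.2
  have := isFiniteMeasure_withDensity_ofReal hi.neg.2
  have heq : (ν.withDensity fun x => ENNReal.ofReal (h x)) =
      ν.withDensity fun x => ENNReal.ofReal ((-h) x) := by
    refine Measure.ext_of_charFun (funext fun t => ?_)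
    rw [charFun_apply_real, charFun_apply_real,
      integral_withDensity_eq_integral_toReal_smul (by fun_prop) (by simp),
      integral_withDensity_eq_integral_toReal_smul (by fun_prop) (by simp), ← sub_eq_zero]
    simp only [ENNReal.toReal_ofReal']
    rw [← integral_sub (hint _ hi.pos_part t) (hint _ hi.neg.pos_part t), ← h0 t]
    refine integral_congr_ae (Filter.Eventually.of_forall fun x => ?_)
    simp only [Pi.neg_apply]
    rw [← sub_smul, max_zero_sub_max_neg_zero_eq_self]
    simp [mul_comm]
  rw [withDensity_eq_iff (by fun_prop) (by fun_prop) hi.lintegral_lt_top.ne] at heq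
  filter_upwards [heq] with x hx
  have := congrArg ENNReal.toReal hx
  simp only [ENNReal.toReal_ofReal', Pi.neg_apply] at this
  rcases le_total (h x) 0 with h1 | h1
  · rw [max_eq_right h1, max_eq_left (by linarith)] at this
    simpa using this.symm
  · rw [max_eq_left h1, max_eq_right (by linarith)] at this
    simpa using this

/-- Under exponential integrability, every polynomial is square-integrable. -/
theorem memLp_two_polynomial_eval {ν : Measure ℝ}
    (hν : ∀ t : ℝ, Integrable (fun x : ℝ => Real.exp (t * |x|)) ν) (q : Polynomial ℝ) :
    MemLp (fun x => q.eval x) 2 ν := by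
  induction q using Polynomial.induction_on' with
  | add p q hp hq =>
    simp only [Polynomial.eval_add]
    exact hp.add hq
  | monomial n a =>
    simp only [Polynomial.eval_monomial]
    refine MemLp.const_mul ?_ a
    rw [memLp_two_iff_integrable_sq (by fun_prop)]
    refine ((hν 1).const_mul ((n * 2).factorial : ℝ)).mono' (by fun_prop)
      (Filter.Eventually.of_forall fun x => ?_)
    have := Real.pow_div_factorial_le_exp |x| (abs_nonneg x) (n * 2)
    rw [div_le_iff₀ (by positivity)] at this
    rw [← pow_mul, Real.norm_eq_abs, abs_pow, one_mul]
    linarith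

theorem memLp_two_exp_mul_abs {ν : Measure ℝ}
    (hν : ∀ t : ℝ, Integrable (fun x : ℝ => Real.exp (t * |x|)) ν) (t : ℝ) :
    MemLp (fun x => Real.exp (t * |x|)) 2 ν := by
  rw [memLp_two_iff_integrable_sq (by fun_prop)]
  refine (hν (2 * t)).congr (Filter.Eventually.of_forall fun x => ?_)
  simp only [← Real.exp_nat_mul]
  push_cast
  ring_nf

/-- Under exponential integrability, a square-integrable function with vanishing moments has
vanishing Fourier transform. -/
theorem integral_cexp_mul_eq_zero_of_moments_eq_zero {ν : Measure ℝ}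
    (hν : ∀ t : ℝ, Integrable (fun x : ℝ => Real.exp (t * |x|)) ν) {h : ℝ → ℝ}
    (hL : MemLp h 2 ν) (h0 : ∀ n : ℕ, ∫ x, x ^ n * h x ∂ν = 0) (t : ℝ) :
    ∫ x, Complex.exp (t * x * Complex.I) * (h x : ℂ) ∂ν = 0 := by
  have hreal : ∀ x : ℝ, HasSum (fun n : ℕ => (|t| * |x|) ^ n / (n.factorial : ℝ) * |h x|)
      (Real.exp (|t| * |x|) * |h x|) := fun x => by
    have := NormedSpace.expSeries_div_hasSum_exp (|t| * |x|)
    rw [← Real.exp_eq_exp_ℝ] at this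
    exact this.mul_right _
  have hsum := hasSum_integral_of_dominated_convergence (μ := ν)
    (F := fun (n : ℕ) (x : ℝ) => (t * x * Complex.I) ^ n / (n.factorial : ℂ) * (h x : ℂ))
    (f := fun x : ℝ => Complex.exp (t * x * Complex.I) * (h x : ℂ))
    (fun n x => (|t| * |x|) ^ n / (n.factorial : ℝ) * |h x|)
    (fun n => (Continuous.aestronglyMeasurable (by fun_prop)).mul
      (Complex.continuous_ofReal.comp_aestronglyMeasurable hL.1))
    (fun n => Filter.Eventually.of_forall fun x => by simp)
    (Filter.Eventually.of_forall fun x => (hreal x).summable)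
    (by
      simp only [fun x => (hreal x).tsum_eq]
      exact (memLp_two_exp_mul_abs hν |t|).integrable_mul hL.abs)
    (Filter.Eventually.of_forall fun x => by
      have := NormedSpace.expSeries_div_hasSum_exp (t * x * Complex.I : ℂ)
      rw [← Complex.exp_eq_exp_ℂ] at this
      exact this.mul_right _)
  refine hsum.unique ?_
  suffices hz : ∀ n : ℕ, ∫ x : ℝ, (t * x * Complex.I) ^ n / (n.factorial : ℂ) * (h x : ℂ) ∂ν = 0 by
    simp only [hz]
    exact hasSum_zero
  intro n
  have : ∀ x : ℝ, (t * x * Complex.I) ^ n / (n.factorial : ℂ) * (h x : ℂ) =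
      ((t * Complex.I) ^ n / (n.factorial : ℂ)) * ((x ^ n * h x : ℝ) : ℂ) := fun x => by
    push_cast; ring
  simp only [this]
  rw [integral_const_mul, integral_complex_ofReal, h0]
  simp

/-- Polynomials are dense in `L²(ν)` when `ν` integrates all exponentials `exp (t |x|)`. -/
theorem dense_polynomials_of_integrable_exp_mul_abs {ν : Measure ℝ}
    (hν : ∀ t : ℝ, Integrable (fun x : ℝ => Real.exp (t * |x|)) ν) :
    Dense {g : Lp ℝ 2 ν | ∃ q : Polynomial ℝ, ∀ᵐ x ∂ν, g x = q.eval x} := by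
  let S : Submodule ℝ (Lp ℝ 2 ν) :=
    { carrier := {g | ∃ q : Polynomial ℝ, ∀ᵐ x ∂ν, g x = q.eval x}
      add_mem' := by
        rintro a b ⟨p, hp⟩ ⟨q, hq⟩
        refine ⟨p + q, ?_⟩
        filter_upwards [hp, hq, Lp.coeFn_add a b] with x h1 h2 h3
        rw [h3, Pi.add_apply, h1, h2, Polynomial.eval_add]
      zero_mem' := by
        refine ⟨0, ?_⟩
        filter_upwards [Lp.coeFn_zero ℝ 2 ν] with x hx
        rw [hx, Pi.zero_apply, Polynomial.eval_zero]
      smul_mem' := by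
        rintro c a ⟨p, hp⟩
        refine ⟨c • p, ?_⟩
        filter_upwards [hp, Lp.coeFn_smul c a] with x h1 h2
        rw [h2, Pi.smul_apply, h1, Polynomial.eval_smul] }
  change Dense (S : Set (Lp ℝ 2 ν))
  rw [Submodule.dense_iff_topologicalClosure_eq_top, Submodule.topologicalClosure_eq_top_iff,
    Submodule.eq_bot_iff]
  intro h hh
  have hL : MemLp h 2 ν := Lp.memLp h
  have hone : MemLp (fun _ : ℝ => (1 : ℝ)) 2 ν := by
    simpa using memLp_two_polynomial_eval hν 1
  have hi : Integrable h ν := by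
    refine (hone.integrable_mul hL).congr (Filter.Eventually.of_forall fun x => ?_)
    simp
  have hmom : ∀ n : ℕ, ∫ x, x ^ n * h x ∂ν = 0 := by
    intro n
    have hp := memLp_two_polynomial_eval hν (Polynomial.X ^ n)
    have := (Submodule.mem_orthogonal _ _).1 hh (hp.toLp _) ⟨Polynomial.X ^ n, hp.coeFn_toLp⟩
    rw [L2.inner_def] at this
    rw [← this]
    refine integral_congr_ae ?_
    filter_upwards [hp.coeFn_toLp] with x hx
    rw [hx]
    simp [mul_comm]
  have := ae_eq_zero_of_forall_integral_cexp_mul_eq_zero (Lp.stronglyMeasurable h).measurable hi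
    (integral_cexp_mul_eq_zero_of_moments_eq_zero hν hL hmom)
  exact (Lp.eq_zero_iff_ae_eq_zero).2 this

theorem integrable_polynomial_eval_mul_exp_neg_mul_sq (p : Polynomial ℝ) {b : ℝ} (hb : 0 < b) :
    Integrable fun x : ℝ => p.eval x * Real.exp (-b * x ^ 2) := by
  induction p using Polynomial.induction_on' with
  | add p q hp hq =>
    simp only [Polynomial.eval_add, add_mul]
    exact hp.add hq
  | monomial n a =>
    have := (integrable_rpow_mul_exp_neg_mul_sq hb
      (show (-1 : ℝ) < n by linarith [n.cast_nonneg (α := ℝ)])).const_mul a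
    simpa only [Polynomial.eval_monomial, Real.rpow_natCast, mul_assoc] using this

/-- For a polynomial map `f : ℝ → ℝⁿ` with graph `M = {(x, f(x))} ⊂ ℝ^{n+1}`, the
polynomial ring `ℝ[x]` is dense in `L²(ℝ, e^{-(x²+‖f(x)‖²)} √(1+‖f'(x)‖²) dx)`. -/
theorem graph_curve_polynomials_dense
    (n : ℕ) (f : Fin n → Polynomial ℝ)
    (ν : Measure ℝ)
    (hν : ν = (volume : Measure ℝ).withDensity
      fun x : ℝ => ENNReal.ofReal
        (Real.exp (-(x ^ 2 + ∑ i, (f i).eval x ^ 2)) *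
          Real.sqrt (1 + ∑ i, ((f i).derivative.eval x) ^ 2))) :
    Dense {g : Lp ℝ 2 ν | ∃ q : Polynomial ℝ, ∀ᵐ x ∂ν, g x = q.eval x} := by
  refine dense_polynomials_of_integrable_exp_mul_abs fun t => ?_
  have hcont : Continuous fun x : ℝ => Real.exp (-(x ^ 2 + ∑ i, (f i).eval x ^ 2)) *
      Real.sqrt (1 + ∑ i, ((f i).derivative.eval x) ^ 2) := by fun_prop
  rw [hν, integrable_withDensity_iff hcont.measurable.ennreal_ofReal (by simp)]
  let P : Polynomial ℝ := 1 + ∑ i, (f i).derivative ^ 2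
  have hP : ∀ x, P.eval x = 1 + ∑ i, ((f i).derivative.eval x) ^ 2 := fun x => by
    simp [P, Polynomial.eval_finsetSum]
  refine ((integrable_polynomial_eval_mul_exp_neg_mul_sq P
    (by norm_num : (0 : ℝ) < 1 / 2)).const_mul (Real.exp (t ^ 2 / 2))).mono'
    (Measurable.aestronglyMeasurable (by
      have := hcont.measurable.ennreal_ofReal.ennreal_toReal
      fun_prop)) (Filter.Eventually.of_forall fun x => ?_)
  have hs : 0 ≤ ∑ i, ((f i).derivative.eval x) ^ 2 := Finset.sum_nonneg fun i _ => sq_nonneg _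
  have hs' : 0 ≤ ∑ i, (f i).eval x ^ 2 := Finset.sum_nonneg fun i _ => sq_nonneg _
  rw [ENNReal.toReal_ofReal (by positivity), Real.norm_of_nonneg (by positivity), hP]
  have hsqrt : Real.sqrt (1 + ∑ i, ((f i).derivative.eval x) ^ 2) ≤
      1 + ∑ i, ((f i).derivative.eval x) ^ 2 :=
    (Real.sqrt_le_left (by positivity)).2 (by nlinarith)
  have hexp : Real.exp (t * |x|) * Real.exp (-(x ^ 2 + ∑ i, (f i).eval x ^ 2)) ≤
      Real.exp (t ^ 2 / 2) * Real.exp (-(1 / 2) * x ^ 2) := by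
    rw [← Real.exp_add, ← Real.exp_add]
    refine Real.exp_le_exp.2 ?_
    nlinarith [sq_nonneg (t - |x|), sq_abs x]
  calc _ = (Real.exp (t * |x|) * Real.exp (-(x ^ 2 + ∑ i, (f i).eval x ^ 2))) *
        Real.sqrt (1 + ∑ i, ((f i).derivative.eval x) ^ 2) := by ring
    _ ≤ (Real.exp (t ^ 2 / 2) * Real.exp (-(1 / 2) * x ^ 2)) *
        (1 + ∑ i, ((f i).derivative.eval x) ^ 2) := by gcongr
    _ = _ := by ring
end
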